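/- arXiv:1712.02082 — 7 statements merged into one kernel-verified Lean document; each statement's English description precedes it below -/
import Mathlib

section
/- For all integers a and k, the quadruple (a, a(k+1)^2 - 2k, a(2k+1)^2 - 8k - 4, a k^2 - 2k - 2) is a D(n)-quadruple with n = 2a(2k+1) + 1; that is, the product of any two distinct components plus 2a(2k+1)+1 is a perfect square (the square of an integer). -/
/-- For all integers `a` and `k`, the quadruple
`(a, a(k+1)^2 - 2k, a(2k+1)^2 - 8k - 4, a k^2 - 2k - 2)` is a `D(n)`-quadruple with
`n = 2a(2k+1) + 1`: the product of any two distinct components plus `n` is a perfect square. -/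
theorem dioph_quadruple_Dn (a k : ℤ) :
    let c : Fin 4 → ℤ :=
      ![a, a * (k + 1) ^ 2 - 2 * k, a * (2 * k + 1) ^ 2 - 8 * k - 4, a * k ^ 2 - 2 * k - 2]
    ∀ i j : Fin 4, i ≠ j →
      ∃ m : ℤ, c i * c j + (2 * a * (2 * k + 1) + 1) = m ^ 2 := by
  intro c i j hij
  have h01 : c 0 * c 1 + (2 * a * (2 * k + 1) + 1) = (a * (k + 1) + 1) ^ 2 := by
    simp [c]; ring
  have h02 : c 0 * c 2 + (2 * a * (2 * k + 1) + 1) = (a * (2 * k + 1) - 1) ^ 2 := by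
    simp [c]; ring
  have h03 : c 0 * c 3 + (2 * a * (2 * k + 1) + 1) = (a * k + 1) ^ 2 := by
    simp [c]; ring
  have h12 : c 1 * c 2 + (2 * a * (2 * k + 1) + 1)
      = (a * (k + 1) * (2 * k + 1) - (4 * k + 1)) ^ 2 := by
    simp [c]; ring
  have h13 : c 1 * c 3 + (2 * a * (2 * k + 1) + 1)
      = (a * k * (k + 1) - (2 * k + 1)) ^ 2 := by
    simp [c]; ring
  have h23 : c 2 * c 3 + (2 * a * (2 * k + 1) + 1)
      = (a * k * (2 * k + 1) - (4 * k + 3)) ^ 2 := by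
    simp [c]; ring
  clear_value c
  fin_cases i <;> fin_cases j <;>
    first
    | exact absurd rfl hij
    | exact ⟨_, h01⟩
    | exact ⟨_, h02⟩
    | exact ⟨_, h03⟩
    | exact ⟨_, h12⟩
    | exact ⟨_, h13⟩
    | exact ⟨_, h23⟩
    | exact ⟨_, (congrArg (· + _) (mul_comm _ _)).trans h01⟩
    | exact ⟨_, (congrArg (· + _) (mul_comm _ _)).trans h02⟩
    | exact ⟨_, (congrArg (· + _) (mul_comm _ _)).trans h03⟩
    | exact ⟨_, (congrArg (· + _) (mul_comm _ _)).trans h12⟩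
    | exact ⟨_, (congrArg (· + _) (mul_comm _ _)).trans h13⟩
    | exact ⟨_, (congrArg (· + _) (mul_comm _ _)).trans h23⟩
end

section
/- In the field ℚ(a,n) of rational functions in two variables a, n over ℚ, set c1 = a/n, c2 = ((n-3)(n-1) + 2a)((n+1)(n+3) + 2a)/(16 a n), c3 = (n-3)(n-1)(n+1)(n+3)/(4 a n), c4 = ((n-3)(n-1) - 2a)((n+1)(n+3) - 2a)/(16 a n). Then (c1, c2, c3, c4) is a rational Diophantine quadruple over ℚ(a,n): for every pair of distinct indices i, j, the element c_i * c_j + 1 is the square of an element of ℚ(a,n). -/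
namespace Stmt1

noncomputable section

/-- The field `ℚ(a,n)` of rational functions in two variables over `ℚ`. -/
abbrev K : Type := FractionRing (MvPolynomial (Fin 2) ℚ)

/-- The variable `a` of `ℚ(a,n)`. -/
def a : K := algebraMap (MvPolynomial (Fin 2) ℚ) K (MvPolynomial.X 0)

/-- The variable `n` of `ℚ(a,n)`. -/
def n : K := algebraMap (MvPolynomial (Fin 2) ℚ) K (MvPolynomial.X 1)

def c : Fin 4 → K :=
  ![a / n,
    ((n - 3) * (n - 1) + 2 * a) * ((n + 1) * (n + 3) + 2 * a) / (16 * a * n),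
    (n - 3) * (n - 1) * (n + 1) * (n + 3) / (4 * a * n),
    ((n - 3) * (n - 1) - 2 * a) * ((n + 1) * (n + 3) - 2 * a) / (16 * a * n)]

/-- A polynomial with a nonzero value at some rational point is nonzero in `ℚ(a,n)`. -/
lemma map_ne_zero_of_eval (p : MvPolynomial (Fin 2) ℚ) (x y : ℚ)
    (h : MvPolynomial.eval ![x, y] p ≠ 0) :
    algebraMap (MvPolynomial (Fin 2) ℚ) K p ≠ 0 := by
  intro h0
  apply h
  have : p = 0 := by
    apply IsFractionRing.injective (MvPolynomial (Fin 2) ℚ) K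
    rw [h0, map_zero]
  rw [this, map_zero]

lemma a_ne : a ≠ 0 := map_ne_zero_of_eval _ 1 1 (by simp)

lemma n_ne : n ≠ 0 := map_ne_zero_of_eval _ 1 1 (by simp)

open MvPolynomial in
lemma num2_ne : ((n - 3) * (n - 1) + 2 * a) * ((n + 1) * (n + 3) + 2 * a) ≠ 0 := by
  have := map_ne_zero_of_eval
    (((X 1 - 3) * (X 1 - 1) + 2 * X 0) * ((X 1 + 1) * (X 1 + 3) + 2 * X 0)) 1 0
    (by simp; norm_num)
  simpa only [a, n, map_mul, map_add, map_sub, map_one, map_ofNat] using this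

open MvPolynomial in
lemma num3_ne : (n - 3) * (n - 1) * (n + 1) * (n + 3) ≠ 0 := by
  have := map_ne_zero_of_eval
    ((X 1 - 3) * (X 1 - 1) * (X 1 + 1) * (X 1 + 3)) 1 0
    (by simp)
  simpa only [a, n, map_mul, map_add, map_sub, map_one, map_ofNat] using this

open MvPolynomial in
lemma num4_ne : ((n - 3) * (n - 1) - 2 * a) * ((n + 1) * (n + 3) - 2 * a) ≠ 0 := by
  have := map_ne_zero_of_eval
    (((X 1 - 3) * (X 1 - 1) - 2 * X 0) * ((X 1 + 1) * (X 1 + 3) - 2 * X 0)) 1 0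
    (by simp; norm_num)
  simpa only [a, n, map_mul, map_add, map_sub, map_one, map_ofNat] using this

lemma sq01 : c 0 * c 1 + 1 = ((n ^ 2 + 3 + 2 * a) / (4 * n)) ^ 2 := by
  have ha := a_ne
  have hn := n_ne
  simp only [c, Matrix.cons_val]
  field_simp
  ring

lemma sq02 : c 0 * c 2 + 1 = ((n ^ 2 - 3) / (2 * n)) ^ 2 := by
  have ha := a_ne
  have hn := n_ne
  simp only [c, Matrix.cons_val]
  field_simp
  ring

lemma sq03 : c 0 * c 3 + 1 = ((n ^ 2 + 3 - 2 * a) / (4 * n)) ^ 2 := by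
  have ha := a_ne
  have hn := n_ne
  simp only [c, Matrix.cons_val]
  field_simp
  ring

lemma sq12 : c 1 * c 2 + 1 =
    (((n - 3) * (n - 1) * (n + 1) * (n + 3) + 2 * a * (n ^ 2 + 3)) / (8 * a * n)) ^ 2 := by
  have ha := a_ne
  have hn := n_ne
  simp only [c, Matrix.cons_val]
  field_simp
  ring

lemma sq13 : c 1 * c 3 + 1 =
    (((n - 3) * (n - 1) * (n + 1) * (n + 3) - 4 * a ^ 2) / (16 * a * n)) ^ 2 := by
  have ha := a_ne
  have hn := n_ne
  simp only [c, Matrix.cons_val]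
  field_simp
  ring

lemma sq23 : c 2 * c 3 + 1 =
    (((n - 3) * (n - 1) * (n + 1) * (n + 3) - 2 * a * (n ^ 2 + 3)) / (8 * a * n)) ^ 2 := by
  have ha := a_ne
  have hn := n_ne
  simp only [c, Matrix.cons_val]
  field_simp
  ring

/-- `(c₁, c₂, c₃, c₄)` is a rational Diophantine quadruple over `ℚ(a,n)`:
its components are nonzero and the product of any two distinct components plus `1` is
a square in `ℚ(a,n)`. -/
theorem c_is_rational_diophantine_quadruple :
    (∀ i : Fin 4, c i ≠ 0) ∧
      ∀ i j : Fin 4, i ≠ j → ∃ t : K, c i * c j + 1 = t ^ 2 := by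
  have ha := a_ne
  have hn := n_ne
  constructor
  · intro i
    fin_cases i
    · exact div_ne_zero ha hn
    · exact div_ne_zero num2_ne (by simp [ha, hn])
    · exact div_ne_zero num3_ne (by simp [ha, hn])
    · exact div_ne_zero num4_ne (by simp [ha, hn])
  · have key : ∀ i j : Fin 4, i < j → ∃ t : K, c i * c j + 1 = t ^ 2 := by
      intro i j hij
      fin_cases i <;> fin_cases j <;> first
        | exact absurd hij (by decide)
        | exact ⟨_, sq01⟩
        | exact ⟨_, sq02⟩
        | exact ⟨_, sq03⟩
        | exact ⟨_, sq12⟩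
        | exact ⟨_, sq13⟩
        | exact ⟨_, sq23⟩
    intro i j hij
    rcases lt_or_gt_of_ne hij with h | h
    · exact key i j h
    · rw [mul_comm]
      exact key j i h

end

end Stmt1
end

section
/- Let c1 = a/n, c2 = ((n-3)(n-1) + 2a)((n+1)(n+3) + 2a)/(16 a n), c3 = (n-3)(n-1)(n+1)(n+3)/(4 a n), c4 = ((n-3)(n-1) - 2a)((n+1)(n+3) - 2a)/(16 a n) in the field ℚ(a,n). Then each of the triples {c1, c2, c4} and {c2, c3, c4} is regular: for each of these two triples there is an ordering (x, y, z) of its elements such that (z - y - x)^2 = 4(x y + 1) holds in ℚ(a,n). -/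
namespace Stmt2

noncomputable section

/-- The field `ℚ(a,n)` of rational functions in two variables over `ℚ`. -/
abbrev K : Type := FractionRing (MvPolynomial (Fin 2) ℚ)

/-- The variable `a` of `ℚ(a,n)`. -/
def a : K := algebraMap (MvPolynomial (Fin 2) ℚ) K (MvPolynomial.X 0)

/-- The variable `n` of `ℚ(a,n)`. -/
def n : K := algebraMap (MvPolynomial (Fin 2) ℚ) K (MvPolynomial.X 1)

def c₁ : K := a / n
def c₂ : K := ((n - 3) * (n - 1) + 2 * a) * ((n + 1) * (n + 3) + 2 * a) / (16 * a * n)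
def c₃ : K := (n - 3) * (n - 1) * (n + 1) * (n + 3) / (4 * a * n)
def c₄ : K := ((n - 3) * (n - 1) - 2 * a) * ((n + 1) * (n + 3) - 2 * a) / (16 * a * n)

/-- A triple of elements of `K` (given as a multiset) is regular if for some ordering
`(x, y, z)` of its elements one has `(z - y - x)^2 = 4(xy + 1)`. -/
def IsRegularTriple (s : Multiset K) : Prop :=
  ∃ x y z : K, ({x, y, z} : Multiset K) = s ∧ (z - y - x) ^ 2 = 4 * (x * y + 1)

theorem a_ne : a ≠ 0 := by
  unfold a
  rw [Ne, FaithfulSMul.algebraMap_eq_zero_iff]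
  exact MvPolynomial.X_ne_zero 0

theorem n_ne : n ≠ 0 := by
  unfold n
  rw [Ne, FaithfulSMul.algebraMap_eq_zero_iff]
  exact MvPolynomial.X_ne_zero 1

theorem field_aux {F : Type} [Field F] [CharZero F] (a n : F) (ha : a ≠ 0) (hn : n ≠ 0) :
    let c₁ := a / n
    let c₂ := ((n - 3) * (n - 1) + 2 * a) * ((n + 1) * (n + 3) + 2 * a) / (16 * a * n)
    let c₃ := (n - 3) * (n - 1) * (n + 1) * (n + 3) / (4 * a * n)
    let c₄ := ((n - 3) * (n - 1) - 2 * a) * ((n + 1) * (n + 3) - 2 * a) / (16 * a * n)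
    (c₄ - c₂ - c₁) ^ 2 = 4 * (c₁ * c₂ + 1) ∧ (c₄ - c₃ - c₂) ^ 2 = 4 * (c₂ * c₃ + 1) := by
  intro c₁ c₂ c₃ c₄
  simp only [c₁, c₂, c₃, c₄]
  constructor <;> field_simp <;> ring

/-- each of the triples `{c₁, c₂, c₄}` and `{c₂, c₃, c₄}` is regular. -/
theorem regular_subtriples :
    IsRegularTriple {c₁, c₂, c₄} ∧ IsRegularTriple {c₂, c₃, c₄} := by
  have : CharZero K := charZero_of_injective_algebraMap
    (IsFractionRing.injective (MvPolynomial (Fin 2) ℚ) K)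
  have h := field_aux a n a_ne n_ne
  exact ⟨⟨c₁, c₂, c₄, rfl, h.1⟩, ⟨c₂, c₃, c₄, rfl, h.2⟩⟩

end

end Stmt2
end

section
/- Let c1 = a/n, c2 = ((n-3)(n-1) + 2a)((n+1)(n+3) + 2a)/(16 a n), c3 = (n-3)(n-1)(n+1)(n+3)/(4 a n), c4 = ((n-3)(n-1) - 2a)((n+1)(n+3) - 2a)/(16 a n) in the field ℚ(a,n). Then the quadruple (c1, c2, c3, c4) is irregular: for each of the three pairings of the indices {1,2,3,4} into two pairs {i,j} and {k,l}, the identity (c_l + c_k - c_i - c_j)^2 = 4(c_i c_j + 1)(c_k c_l + 1) fails in ℚ(a,n). -/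
namespace Stmt3

noncomputable section

/-- The field `ℚ(a,n)` of rational functions in two variables over `ℚ`. -/
abbrev K : Type := FractionRing (MvPolynomial (Fin 2) ℚ)

/-- The variable `a` of `ℚ(a,n)`. -/
def a : K := algebraMap (MvPolynomial (Fin 2) ℚ) K (MvPolynomial.X 0)

/-- The variable `n` of `ℚ(a,n)`. -/
def n : K := algebraMap (MvPolynomial (Fin 2) ℚ) K (MvPolynomial.X 1)

def c₁ : K := a / n
def c₂ : K := ((n - 3) * (n - 1) + 2 * a) * ((n + 1) * (n + 3) + 2 * a) / (16 * a * n)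
def c₃ : K := (n - 3) * (n - 1) * (n + 1) * (n + 3) / (4 * a * n)
def c₄ : K := ((n - 3) * (n - 1) - 2 * a) * ((n + 1) * (n + 3) - 2 * a) / (16 * a * n)

open MvPolynomial in
/-- Clearing denominators and specializing a regularity identity at a rational point. -/
theorem specialize_identity (p q r s d : MvPolynomial (Fin 2) ℚ) (w x y z : K)
    (hd : d ≠ 0)
    (hw : w = algebraMap (MvPolynomial (Fin 2) ℚ) K p / algebraMap (MvPolynomial (Fin 2) ℚ) K d)
    (hx : x = algebraMap (MvPolynomial (Fin 2) ℚ) K q / algebraMap (MvPolynomial (Fin 2) ℚ) K d)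
    (hy : y = algebraMap (MvPolynomial (Fin 2) ℚ) K r / algebraMap (MvPolynomial (Fin 2) ℚ) K d)
    (hz : z = algebraMap (MvPolynomial (Fin 2) ℚ) K s / algebraMap (MvPolynomial (Fin 2) ℚ) K d)
    (h : (z + y - w - x) ^ 2 = 4 * (w * x + 1) * (y * z + 1)) (v : Fin 2 → ℚ) :
    (eval v s + eval v r - eval v p - eval v q) ^ 2 * (eval v d) ^ 2 =
      4 * (eval v p * eval v q + (eval v d) ^ 2) * (eval v r * eval v s + (eval v d) ^ 2) := by
  have hinj := IsFractionRing.injective (MvPolynomial (Fin 2) ℚ) K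
  have hd' : algebraMap (MvPolynomial (Fin 2) ℚ) K d ≠ 0 := fun h0 =>
    hd (hinj (by rw [h0, map_zero]))
  have hpoly : (s + r - p - q) ^ 2 * d ^ 2 = 4 * (p * q + d ^ 2) * (r * s + d ^ 2) := by
    apply hinj
    subst hw hx hy hz
    simp only [map_mul, map_add, map_sub, map_pow, map_ofNat]
    generalize algebraMap (MvPolynomial (Fin 2) ℚ) K p = p' at *
    generalize algebraMap (MvPolynomial (Fin 2) ℚ) K q = q' at *
    generalize algebraMap (MvPolynomial (Fin 2) ℚ) K r = r' at *
    generalize algebraMap (MvPolynomial (Fin 2) ℚ) K s = s' at *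
    generalize algebraMap (MvPolynomial (Fin 2) ℚ) K d = d' at *
    field_simp at h
    linear_combination h
  have := congrArg (eval v) hpoly
  simpa only [map_mul, map_add, map_sub, map_pow, map_ofNat] using this

open MvPolynomial in
/-- The common denominator. -/
def den : MvPolynomial (Fin 2) ℚ := 16 * X 0 * X 1

open MvPolynomial in
def num₁ : MvPolynomial (Fin 2) ℚ := 16 * X 0 ^ 2

open MvPolynomial in
def num₂ : MvPolynomial (Fin 2) ℚ :=
  ((X 1 - 3) * (X 1 - 1) + 2 * X 0) * ((X 1 + 1) * (X 1 + 3) + 2 * X 0)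

open MvPolynomial in
def num₃ : MvPolynomial (Fin 2) ℚ := 4 * ((X 1 - 3) * (X 1 - 1) * (X 1 + 1) * (X 1 + 3))

open MvPolynomial in
def num₄ : MvPolynomial (Fin 2) ℚ :=
  ((X 1 - 3) * (X 1 - 1) - 2 * X 0) * ((X 1 + 1) * (X 1 + 3) - 2 * X 0)

theorem den_ne_zero : den ≠ 0 := by
  intro h
  have := congrArg (MvPolynomial.eval ![(1 : ℚ), 2]) h
  simp [den] at this

theorem a_ne_zero : a ≠ 0 := by
  intro h
  have h' := IsFractionRing.injective (MvPolynomial (Fin 2) ℚ) K (h.trans (map_zero _).symm)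
  exact MvPolynomial.X_ne_zero _ h'

theorem n_ne_zero : n ≠ 0 := by
  intro h
  have h' := IsFractionRing.injective (MvPolynomial (Fin 2) ℚ) K (h.trans (map_zero _).symm)
  exact MvPolynomial.X_ne_zero _ h'

theorem c1_eq : c₁ = algebraMap (MvPolynomial (Fin 2) ℚ) K num₁ /
    algebraMap (MvPolynomial (Fin 2) ℚ) K den := by
  have ha := a_ne_zero
  have hn := n_ne_zero
  simp only [c₁, num₁, den, map_mul, map_add, map_sub, map_pow, map_ofNat, map_one]
  change _ = _ / (16 * a * n)
  simp only [← a.eq_def, ← n.eq_def]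
  try field_simp
  try ring

theorem c2_eq : c₂ = algebraMap (MvPolynomial (Fin 2) ℚ) K num₂ /
    algebraMap (MvPolynomial (Fin 2) ℚ) K den := by
  have ha := a_ne_zero
  have hn := n_ne_zero
  simp only [c₂, num₂, den, map_mul, map_add, map_sub, map_pow, map_ofNat, map_one]
  change _ = _ / (16 * a * n)
  simp only [← a.eq_def, ← n.eq_def]
  try field_simp
  try ring

theorem c3_eq : c₃ = algebraMap (MvPolynomial (Fin 2) ℚ) K num₃ /
    algebraMap (MvPolynomial (Fin 2) ℚ) K den := by
  have ha := a_ne_zero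
  have hn := n_ne_zero
  simp only [c₃, num₃, den, map_mul, map_add, map_sub, map_pow, map_ofNat, map_one]
  change _ = _ / (16 * a * n)
  simp only [← a.eq_def, ← n.eq_def]
  try field_simp
  try ring

theorem c4_eq : c₄ = algebraMap (MvPolynomial (Fin 2) ℚ) K num₄ /
    algebraMap (MvPolynomial (Fin 2) ℚ) K den := by
  have ha := a_ne_zero
  have hn := n_ne_zero
  simp only [c₄, num₄, den, map_mul, map_add, map_sub, map_pow, map_ofNat, map_one]
  change _ = _ / (16 * a * n)
  simp only [← a.eq_def, ← n.eq_def]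
  try field_simp
  try ring

/-- the quadruple `(c₁, c₂, c₃, c₄)` is irregular: for each of the three
pairings of the indices `{1,2,3,4}` into two pairs `{i,j}` and `{k,l}`, the regularity
identity `(c_l + c_k - c_i - c_j)^2 = 4(c_i c_j + 1)(c_k c_l + 1)` fails in `ℚ(a,n)`. -/
theorem quadruple_is_irregular :
    (c₄ + c₃ - c₁ - c₂) ^ 2 ≠ 4 * (c₁ * c₂ + 1) * (c₃ * c₄ + 1) ∧
    (c₄ + c₂ - c₁ - c₃) ^ 2 ≠ 4 * (c₁ * c₃ + 1) * (c₂ * c₄ + 1) ∧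
    (c₃ + c₂ - c₁ - c₄) ^ 2 ≠ 4 * (c₁ * c₄ + 1) * (c₂ * c₃ + 1) := by
  refine ⟨fun h => ?_, fun h => ?_, fun h => ?_⟩
  · have := specialize_identity num₁ num₂ num₃ num₄ den _ _ _ _ den_ne_zero
      c1_eq c2_eq c3_eq c4_eq (by linear_combination h) ![1, 2]
    norm_num [num₁, num₂, num₃, num₄, den] at this
  · have := specialize_identity num₁ num₃ num₂ num₄ den _ _ _ _ den_ne_zero
      c1_eq c3_eq c2_eq c4_eq (by linear_combination h) ![1, 2]
    norm_num [num₁, num₂, num₃, num₄, den] at this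
  · have := specialize_identity num₁ num₄ num₂ num₃ den _ _ _ _ den_ne_zero
      c1_eq c4_eq c2_eq c3_eq (by linear_combination h) ![1, 2]
    norm_num [num₁, num₂, num₃, num₄, den] at this

end

end Stmt3
end

section
/- Let c1, c2, c3 be nonzero rational numbers and let t12, t13, t23 be rational numbers with c1 c2 + 1 = t12^2, c1 c3 + 1 = t13^2, c2 c3 + 1 = t23^2. Then the point with coordinates x = (t12 t13 + t12 t23 + t13 t23 + 1)/(c1 c2 c3) and y = (t12 + t13)(t12 + t23)(t13 + t23)/(c1 c2 c3) satisfies the equation y^2 = (c1 x + 1)(c2 x + 1)(c3 x + 1). -/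
/-- if `{c₁, c₂, c₃}` is a rational Diophantine triple with
`cᵢ cⱼ + 1 = tᵢⱼ²`, then the point
`x = (t₁₂ t₁₃ + t₁₂ t₂₃ + t₁₃ t₂₃ + 1)/(c₁ c₂ c₃)`,
`y = (t₁₂ + t₁₃)(t₁₂ + t₂₃)(t₁₃ + t₂₃)/(c₁ c₂ c₃)`
lies on the curve `y² = (c₁ x + 1)(c₂ x + 1)(c₃ x + 1)` induced by the triple. -/
theorem point_on_induced_curve (c₁ c₂ c₃ t₁₂ t₁₃ t₂₃ : ℚ)
    (hc₁ : c₁ ≠ 0) (hc₂ : c₂ ≠ 0) (hc₃ : c₃ ≠ 0)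
    (h₁₂ : c₁ * c₂ + 1 = t₁₂ ^ 2) (h₁₃ : c₁ * c₃ + 1 = t₁₃ ^ 2)
    (h₂₃ : c₂ * c₃ + 1 = t₂₃ ^ 2) :
    let x : ℚ := (t₁₂ * t₁₃ + t₁₂ * t₂₃ + t₁₃ * t₂₃ + 1) / (c₁ * c₂ * c₃)
    let y : ℚ := (t₁₂ + t₁₃) * (t₁₂ + t₂₃) * (t₁₃ + t₂₃) / (c₁ * c₂ * c₃)
    y ^ 2 = (c₁ * x + 1) * (c₂ * x + 1) * (c₃ * x + 1) := by
  intro x y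
  have h1 : c₁ * x + 1 = (t₂₃ + t₁₂) * (t₂₃ + t₁₃) / (c₂ * c₃) := by
    simp only [x]
    field_simp
    linear_combination h₂₃
  have h2 : c₂ * x + 1 = (t₁₃ + t₁₂) * (t₁₃ + t₂₃) / (c₁ * c₃) := by
    simp only [x]
    field_simp
    linear_combination h₁₃
  have h3 : c₃ * x + 1 = (t₁₂ + t₁₃) * (t₁₂ + t₂₃) / (c₁ * c₂) := by
    simp only [x]
    field_simp
    linear_combination h₁₂
  rw [h1, h2, h3]
  simp only [y]
  field_simp
  try ring
end

section
/- In the field ℚ(v) of rational functions in one variable over ℚ, set q1 = 2(-27 + 13v^2)(-13 + 27v^2) / (21(9 + 178v^2 + 9v^4)), q2 = -(9 + 8018v^2 + 9v^4)(369 - 542v^2 + 369v^4) / (42(-27 + 13v^2)(-13 + 27v^2)(9 + 178v^2 + 9v^4)), q3 = -160(9 + 178v^2 + 9v^4) / (21(-27 + 13v^2)(-13 + 27v^2)), q4 = 3(111 - 418v^2 + 111v^4)(237 + 2074v^2 + 237v^4) / (14(-27 + 13v^2)(-13 + 27v^2)(9 + 178v^2 + 9v^4)). Then (q1, q2, q3,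 q4) is a rational Diophantine quadruple over ℚ(v): for every pair of distinct indices i, j, the element q_i * q_j + 1 is the square of an element of ℚ(v). -/
namespace Stmt10

noncomputable section

/-- The field `ℚ(v)` of rational functions in one variable over `ℚ`. -/
abbrev K : Type := RatFunc ℚ

/-- The variable `v` of `ℚ(v)`. -/
def v : K := RatFunc.X

def q : Fin 4 → K :=
  ![2 * (-27 + 13 * v ^ 2) * (-13 + 27 * v ^ 2) / (21 * (9 + 178 * v ^ 2 + 9 * v ^ 4)),
    -((9 + 8018 * v ^ 2 + 9 * v ^ 4) * (369 - 542 * v ^ 2 + 369 * v ^ 4))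
      / (42 * (-27 + 13 * v ^ 2) * (-13 + 27 * v ^ 2) * (9 + 178 * v ^ 2 + 9 * v ^ 4)),
    -(160 * (9 + 178 * v ^ 2 + 9 * v ^ 4)) / (21 * (-27 + 13 * v ^ 2) * (-13 + 27 * v ^ 2)),
    3 * (111 - 418 * v ^ 2 + 111 * v ^ 4) * (237 + 2074 * v ^ 2 + 237 * v ^ 4)
      / (14 * (-27 + 13 * v ^ 2) * (-13 + 27 * v ^ 2) * (9 + 178 * v ^ 2 + 9 * v ^ 4))]

/-- A polynomial expression in `v` with nonzero constant term is nonzero. -/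
lemma quartic_ne (a b c : ℚ) (ha : a ≠ 0) :
    (RatFunc.C a + RatFunc.C b * v ^ 2 + RatFunc.C c * v ^ 4 : K) ≠ 0 := by
  have h : (RatFunc.C a + RatFunc.C b * v ^ 2 + RatFunc.C c * v ^ 4 : K)
      = algebraMap (Polynomial ℚ) K
        (Polynomial.C a + Polynomial.C b * Polynomial.X ^ 2
          + Polynomial.C c * Polynomial.X ^ 4) := by
    simp [v, RatFunc.algebraMap_X, RatFunc.algebraMap_C]
  rw [h]
  intro h0
  have h1 := (map_eq_zero_iff _ (RatFunc.algebraMap_injective ℚ)).1 h0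
  have h2 := congrArg (Polynomial.eval 0) h1
  simp at h2
  exact ha h2

lemma ne_a : (-27 + 13 * v ^ 2 : K) ≠ 0 := by
  have h := quartic_ne (-27) (13) (0) (by norm_num)
  simp only [map_neg, map_ofNat, map_zero] at h
  intro h0
  apply h
  linear_combination h0

lemma ne_b : (-13 + 27 * v ^ 2 : K) ≠ 0 := by
  have h := quartic_ne (-13) (27) (0) (by norm_num)
  simp only [map_neg, map_ofNat, map_zero] at h
  intro h0
  apply h
  linear_combination h0

lemma ne_c : (9 + 178 * v ^ 2 + 9 * v ^ 4 : K) ≠ 0 := by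
  have h := quartic_ne (9) (178) (9) (by norm_num)
  simp only [map_neg, map_ofNat, map_zero] at h
  intro h0
  apply h
  linear_combination h0

lemma ne_d : (9 + 8018 * v ^ 2 + 9 * v ^ 4 : K) ≠ 0 := by
  have h := quartic_ne (9) (8018) (9) (by norm_num)
  simp only [map_neg, map_ofNat, map_zero] at h
  intro h0
  apply h
  linear_combination h0

lemma ne_e : (369 - 542 * v ^ 2 + 369 * v ^ 4 : K) ≠ 0 := by
  have h := quartic_ne (369) (-542) (369) (by norm_num)
  simp only [map_neg, map_ofNat, map_zero] at h
  intro h0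
  apply h
  linear_combination h0

lemma ne_f : (111 - 418 * v ^ 2 + 111 * v ^ 4 : K) ≠ 0 := by
  have h := quartic_ne (111) (-418) (111) (by norm_num)
  simp only [map_neg, map_ofNat, map_zero] at h
  intro h0
  apply h
  linear_combination h0

lemma ne_g : (237 + 2074 * v ^ 2 + 237 * v ^ 4 : K) ≠ 0 := by
  have h := quartic_ne (237) (2074) (237) (by norm_num)
  simp only [map_neg, map_ofNat, map_zero] at h
  intro h0
  apply h
  linear_combination h0

lemma pair01 : ∃ t : K, q 0 * q 1 + 1 = t ^ 2 := by
  have ha := ne_a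
  have hb := ne_b
  have hc := ne_c
  refine ⟨(180 - 4280 * v ^ 2 + 180 * v ^ 4) / (21 * (9 + 178 * v ^ 2 + 9 * v ^ 4)), ?_⟩
  simp only [q, Matrix.cons_val]
  generalize v = x at *
  generalize hA : -27 + 13 * x ^ 2 = a at *
  generalize hB : -13 + 27 * x ^ 2 = b at *
  generalize hC : 9 + 178 * x ^ 2 + 9 * x ^ 4 = c at *
  field_simp
  subst hA hB hC
  ring

lemma pair02 : ∃ t : K, q 0 * q 2 + 1 = t ^ 2 := by
  have ha := ne_a
  have hb := ne_b
  have hc := ne_c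
  refine ⟨11 / 21, ?_⟩
  simp only [q, Matrix.cons_val]
  generalize v = x at *
  generalize hA : -27 + 13 * x ^ 2 = a at *
  generalize hB : -13 + 27 * x ^ 2 = b at *
  generalize hC : 9 + 178 * x ^ 2 + 9 * x ^ 4 = c at *
  field_simp
  subst hA hB hC
  ring

lemma pair03 : ∃ t : K, q 0 * q 3 + 1 = t ^ 2 := by
  have ha := ne_a
  have hb := ne_b
  have hc := ne_c
  refine ⟨(174 + 828 * v ^ 2 + 174 * v ^ 4) / (7 * (9 + 178 * v ^ 2 + 9 * v ^ 4)), ?_⟩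
  simp only [q, Matrix.cons_val]
  generalize v = x at *
  generalize hA : -27 + 13 * x ^ 2 = a at *
  generalize hB : -13 + 27 * x ^ 2 = b at *
  generalize hC : 9 + 178 * x ^ 2 + 9 * x ^ 4 = c at *
  field_simp
  subst hA hB hC
  ring

lemma pair12 : ∃ t : K, q 1 * q 2 + 1 = t ^ 2 := by
  have ha := ne_a
  have hb := ne_b
  have hc := ne_c
  refine ⟨(7389 - 2822 * v ^ 2 + 7389 * v ^ 4) / (21 * ((-27 + 13 * v ^ 2) * (-13 + 27 * v ^ 2))), ?_⟩
  simp only [q, Matrix.cons_val]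
  generalize v = x at *
  generalize hA : -27 + 13 * x ^ 2 = a at *
  generalize hB : -13 + 27 * x ^ 2 = b at *
  generalize hC : 9 + 178 * x ^ 2 + 9 * x ^ 4 = c at *
  field_simp
  subst hA hB hC
  ring

lemma pair13 : ∃ t : K, q 1 * q 3 + 1 = t ^ 2 := by
  have ha := ne_a
  have hb := ne_b
  have hc := ne_c
  refine ⟨(43227 - 124692 * v ^ 2 + 1200162 * v ^ 4 - 124692 * v ^ 6 + 43227 * v ^ 8)
      / (14 * ((-27 + 13 * v ^ 2) * (-13 + 27 * v ^ 2)) * (9 + 178 * v ^ 2 + 9 * v ^ 4)), ?_⟩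
  simp only [q, Matrix.cons_val]
  generalize v = x at *
  generalize hA : -27 + 13 * x ^ 2 = a at *
  generalize hB : -13 + 27 * x ^ 2 = b at *
  generalize hC : 9 + 178 * x ^ 2 + 9 * x ^ 4 = c at *
  field_simp
  subst hA hB hC
  ring

lemma pair23 : ∃ t : K, q 2 * q 3 + 1 = t ^ 2 := by
  have ha := ne_a
  have hb := ne_b
  have hc := ne_c
  refine ⟨(1983 - 10434 * v ^ 2 + 1983 * v ^ 4) / (7 * ((-27 + 13 * v ^ 2) * (-13 + 27 * v ^ 2))), ?_⟩
  simp only [q, Matrix.cons_val]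
  generalize v = x at *
  generalize hA : -27 + 13 * x ^ 2 = a at *
  generalize hB : -13 + 27 * x ^ 2 = b at *
  generalize hC : 9 + 178 * x ^ 2 + 9 * x ^ 4 = c at *
  field_simp
  subst hA hB hC
  ring

/-- `(q₁, q₂, q₃, q₄)` is a rational Diophantine quadruple over `ℚ(v)`:
its components are nonzero and the product of any two distinct components plus `1` is
a square in `ℚ(v)`. -/
theorem q_is_rational_diophantine_quadruple :
    (∀ i : Fin 4, q i ≠ 0) ∧
      ∀ i j : Fin 4, i ≠ j → ∃ t : K, q i * q j + 1 = t ^ 2 := by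
  constructor
  · have ha := ne_a
    have hb := ne_b
    have hc := ne_c
    have hd := ne_d
    have he := ne_e
    have hf := ne_f
    have hg := ne_g
    intro i
    fin_cases i <;> simp [q, ha, hb, hc, hd, he, hf, hg]
  · intro i j hij
    have sw : ∀ i j : Fin 4, (∃ t : K, q i * q j + 1 = t ^ 2) →
        ∃ t : K, q j * q i + 1 = t ^ 2 := by
      intro i j h
      rwa [mul_comm]
    fin_cases i <;> fin_cases j <;>
      first
      | exact absurd rfl hij
      | exact pair01
      | exact pair02
      | exact pair03
      | exact pair12
      | exact pair13
      | exact pair23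
      | exact sw _ _ pair01
      | exact sw _ _ pair02
      | exact sw _ _ pair03
      | exact sw _ _ pair12
      | exact sw _ _ pair13
      | exact sw _ _ pair23

end

end Stmt10
end

section
/- In the field ℚ(u) of rational functions in one variable over ℚ, set a = (u^3 - 9u)/(6(u^2 - 1)), b = -18(u^2 - 1)/(4(u^3 - 9u)), c1 = (9 - 12u - 18u^2 + 4u^3 + u^4)/(6u(u^2 + 2u - 3)), c2 = (9 + 12u - 18u^2 - 4u^3 + u^4)/(6u(u^2 - 2u - 3)), c3 = -16u(u^2 - 3)/(3(u^4 - 10u^2 + 9)). Then (a, b, c1, c2, c3) is a rational Diophantine quintuple over ℚ(u): for every pair of distinct components x, y among these five, the element x*y + 1 is the square of an element of ℚ(u). -/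
namespace Stmt14

noncomputable section

/-- The field `ℚ(u)` of rational functions in one variable over `ℚ`. -/
abbrev K : Type := RatFunc ℚ

/-- The variable `u` of `ℚ(u)`. -/
def u : K := RatFunc.X

def c : Fin 5 → K :=
  ![(u ^ 3 - 9 * u) / (6 * (u ^ 2 - 1)),
    -(18 * (u ^ 2 - 1)) / (4 * (u ^ 3 - 9 * u)),
    (9 - 12 * u - 18 * u ^ 2 + 4 * u ^ 3 + u ^ 4) / (6 * (u * (u ^ 2 + 2 * u - 3))),
    (9 + 12 * u - 18 * u ^ 2 - 4 * u ^ 3 + u ^ 4) / (6 * (u * (u ^ 2 - 2 * u - 3))),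
    -(16 * u * (u ^ 2 - 3)) / (3 * (u ^ 4 - 10 * u ^ 2 + 9))]

open Polynomial in
theorem ne_of_eval (p : ℚ[X]) (q : ℚ) (h : p.eval q ≠ 0) : aeval u p ≠ 0 := by
  have hp : p ≠ 0 := by
    rintro rfl
    simp at h
  have e : aeval u p = algebraMap ℚ[X] (RatFunc ℚ) p := by
    rw [u, ← RatFunc.algebraMap_X, aeval_algebraMap_apply]
    simp
  rw [e]
  exact (map_ne_zero_iff _ (RatFunc.algebraMap_injective ℚ)).2 hp

open Polynomial in
theorem h0 : u ≠ 0 := by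
  have h := ne_of_eval (X) 2 (by norm_num)
  simpa using h

open Polynomial in
theorem h1 : u - 1 ≠ 0 := by
  have h := ne_of_eval (X - C 1) 2 (by norm_num)
  simpa using h

open Polynomial in
theorem h2 : u + 1 ≠ 0 := by
  have h := ne_of_eval (X + C 1) 2 (by norm_num)
  simpa using h

open Polynomial in
theorem h3 : u - 3 ≠ 0 := by
  have h := ne_of_eval (X - C 3) 2 (by norm_num)
  simpa using h

open Polynomial in
theorem h4 : u + 3 ≠ 0 := by
  have h := ne_of_eval (X + C 3) 2 (by norm_num)
  simpa using h

open Polynomial in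
theorem k2 : 9 - 12 * u - 18 * u ^ 2 + 4 * u ^ 3 + u ^ 4 ≠ 0 := by
  have h := ne_of_eval (C 9 - C 12 * X - C 18 * X ^ 2 + C 4 * X ^ 3 + X ^ 4) 0 (by norm_num)
  simpa using h

open Polynomial in
theorem k3 : 9 + 12 * u - 18 * u ^ 2 - 4 * u ^ 3 + u ^ 4 ≠ 0 := by
  have h := ne_of_eval (C 9 + C 12 * X - C 18 * X ^ 2 - C 4 * X ^ 3 + X ^ 4) 0 (by norm_num)
  simpa using h

open Polynomial in
theorem k4 : u ^ 2 - 3 ≠ 0 := by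
  have h := ne_of_eval (X ^ 2 - C 3) 0 (by norm_num)
  simpa using h

theorem c_0 : c 0 = u * (u - 3) * (u + 3) / (6 * ((u - 1) * (u + 1))) := by
  simp only [c, Matrix.cons_val]
  congr 1 <;> ring

theorem c_1 : c 1 = -(18 * ((u - 1) * (u + 1))) / (4 * (u * (u - 3) * (u + 3))) := by
  simp only [c, Matrix.cons_val]
  congr 1 <;> ring

theorem c_2 : c 2 = (9 - 12 * u - 18 * u ^ 2 + 4 * u ^ 3 + u ^ 4) / (6 * (u * ((u - 1) * (u + 3)))) := by
  simp only [c, Matrix.cons_val]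
  congr 1 <;> ring

theorem c_3 : c 3 = (9 + 12 * u - 18 * u ^ 2 - 4 * u ^ 3 + u ^ 4) / (6 * (u * ((u + 1) * (u - 3)))) := by
  simp only [c, Matrix.cons_val]
  congr 1 <;> ring

theorem c_4 : c 4 = -(16 * u * (u ^ 2 - 3)) / (3 * ((u - 1) * (u + 1) * ((u - 3) * (u + 3)))) := by
  simp only [c, Matrix.cons_val]
  congr 1 <;> ring

theorem s_0_1 : c 0 * c 1 + 1 = (1 / 2) ^ 2 := by
  have := h0; have := h1; have := h2; have := h3; have := h4
  rw [c_0, c_1]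
  field_simp
  ring

theorem s_0_2 : c 0 * c 2 + 1 = ((u^2+3)/(6*(u-1))) ^ 2 := by
  have := h0; have := h1; have := h2; have := h3; have := h4
  rw [c_0, c_2]
  field_simp
  ring

theorem s_0_3 : c 0 * c 3 + 1 = ((u^2+3)/(6*(u+1))) ^ 2 := by
  have := h0; have := h1; have := h2; have := h3; have := h4
  rw [c_0, c_3]
  field_simp
  ring

theorem s_0_4 : c 0 * c 4 + 1 = ((u^2+3)/(3*((u-1)*(u+1)))) ^ 2 := by
  have := h0; have := h1; have := h2; have := h3; have := h4
  rw [c_0, c_4]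
  field_simp
  ring

theorem s_1_2 : c 1 * c 2 + 1 = ((u^2+3)/(2*(u*(u+3)))) ^ 2 := by
  have := h0; have := h1; have := h2; have := h3; have := h4
  rw [c_1, c_2]
  field_simp
  ring

theorem s_1_3 : c 1 * c 3 + 1 = ((u^2+3)/(2*(u*(u-3)))) ^ 2 := by
  have := h0; have := h1; have := h2; have := h3; have := h4
  rw [c_1, c_3]
  field_simp
  ring

theorem s_1_4 : c 1 * c 4 + 1 = ((u^2+3)/((u-3)*(u+3))) ^ 2 := by
  have := h0; have := h1; have := h2; have := h3; have := h4
  rw [c_1, c_4]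
  field_simp
  ring

theorem s_2_3 : c 2 * c 3 + 1 = ((u^2-3)/(6*u)) ^ 2 := by
  have := h0; have := h1; have := h2; have := h3; have := h4
  rw [c_2, c_3]
  field_simp
  ring

theorem s_2_4 : c 2 * c 4 + 1 = ((u^2-6*u-3)/(3*((u-1)*(u+3)))) ^ 2 := by
  have := h0; have := h1; have := h2; have := h3; have := h4
  rw [c_2, c_4]
  field_simp
  ring

theorem s_3_4 : c 3 * c 4 + 1 = ((u^2+6*u-3)/(3*((u+1)*(u-3)))) ^ 2 := by
  have := h0; have := h1; have := h2; have := h3; have := h4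
  rw [c_3, c_4]
  field_simp
  ring

/-- `(a, b, c₁, c₂, c₃)` is a rational Diophantine quintuple over `ℚ(u)`:
its components are nonzero and the product of any two distinct components plus `1` is
a square in `ℚ(u)`. -/
theorem quintuple_is_rational_diophantine :
    (∀ i : Fin 5, c i ≠ 0) ∧
      ∀ i j : Fin 5, i ≠ j → ∃ t : K, c i * c j + 1 = t ^ 2 := by
  have g0 := h0; have g1 := h1; have g2 := h2; have g3 := h3; have g4 := h4
  have g5 := k2; have g6 := k3; have g7 := k4
  have key : ∀ i j : Fin 5, i < j → ∃ t : K, c i * c j + 1 = t ^ 2 := by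
    intro i j hij
    fin_cases i <;> fin_cases j <;> first
      | exact absurd hij (by decide)
      | exact ⟨_, s_0_1⟩
      | exact ⟨_, s_0_2⟩
      | exact ⟨_, s_0_3⟩
      | exact ⟨_, s_0_4⟩
      | exact ⟨_, s_1_2⟩
      | exact ⟨_, s_1_3⟩
      | exact ⟨_, s_1_4⟩
      | exact ⟨_, s_2_3⟩
      | exact ⟨_, s_2_4⟩
      | exact ⟨_, s_3_4⟩
  constructor
  · intro i
    fin_cases i
    · exact c_0 ▸ by simp [*]
    · exact c_1 ▸ by simp [*]
    · exact c_2 ▸ by simp [*]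
    · exact c_3 ▸ by simp [*]
    · exact c_4 ▸ by simp [*]
  · intro i j hij
    rcases lt_or_gt_of_ne hij with h | h
    · exact key i j h
    · rw [mul_comm]
      exact key j i h

end

end Stmt14
end
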